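/- arXiv:1410.2586 — 8 statements merged into one kernel-verified Lean document; each statement's English description precedes it below -/
import Mathlib

section
/- Let X be a real Hilbert space, Y a real normed space, T : X → Y an injective compact continuous linear map, and p : X → ℝ a continuous seminorm such that ‖x‖_X² ≤ p(x)² + ‖T x‖_Y² for all x ∈ X. Let ℓ_m : X × X → ℝ be a symmetric continuous bilinear form which is sequentially weakly lower semicontinuous on the diagonal and satisfies ℓ_m(x,x) ≥ C₁ p(x)² for ALL x ∈ X, for some C₁ > 0; let b be a continuous bilinear form on Y, ℓ_r(x,x') := b(T x, T x'), ℓ := ℓ_m + ℓ_r. Let L₁, …, L_N be continuous linear functionals on Y and V := {x ∈ X : L_i(T x) = 0 for i = 1,…,N}. If ℓ(x,x) > 0 for every x ∈ V \ {0}, then there exist constants C₀ > 0 and λ > 0 such that ℓ(x,x) + C₀ · Σ_{i=1}^{N} (L_i(T x))² ≥ λ ‖x‖_X² for every x ∈ X. -/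
open Filter

/-- A bounded family in a Hilbert space converges weakly along every ultrafilter. -/
theorem exists_forall_tendsto_of_norm_le {X ι : Type*} [NormedAddCommGroup X]
    [InnerProductSpace ℝ X] [CompleteSpace X] (F : Ultrafilter ι) (u : ι → X) (r : ℝ)
    (hu : ∀ i, ‖u i‖ ≤ r) :
    ∃ x₀ : X, ∀ f : X →L[ℝ] ℝ, Tendsto (fun i => f (u i)) F (nhds (f x₀)) := by
  have hcpt := WeakDual.isCompact_closedBall (𝕜 := ℝ) (E := X) 0 r
  let v : ι → WeakDual ℝ X := fun i => StrongDual.toWeakDual (InnerProductSpace.toDual ℝ X (u i))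
  obtain ⟨φ, -, hφ⟩ := hcpt.ultrafilter_le_nhds (F.map v) (by
    rw [le_principal_iff]
    refine Filter.mem_map.2 (Filter.univ_mem' fun i => ?_)
    simpa [v] using hu i)
  refine ⟨(InnerProductSpace.toDual ℝ X).symm (WeakDual.toStrongDual φ), fun f => ?_⟩
  obtain ⟨w, rfl⟩ := (InnerProductSpace.toDual ℝ X).surjective f
  have hlim : Tendsto (fun i => v i w) F (nhds (φ w)) :=
    ((WeakDual.eval_continuous w).tendsto φ).comp hφ
  have hw : InnerProductSpace.toDual ℝ X w
      ((InnerProductSpace.toDual ℝ X).symm (WeakDual.toStrongDual φ)) = φ w := by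
    rw [InnerProductSpace.toDual_apply_apply, real_inner_comm,
      InnerProductSpace.toDual_symm_apply]
    rfl
  rw [hw]
  refine hlim.congr fun i => ?_
  simp [v, real_inner_comm]

/-- A compact operator on a Hilbert space maps a bounded family, along an ultrafilter, to a family
converging in norm to the image of the weak limit. -/
theorem exists_weak_limit_tendsto_map {X Y ι : Type*} [NormedAddCommGroup X]
    [InnerProductSpace ℝ X] [CompleteSpace X] [NormedAddCommGroup Y] [NormedSpace ℝ Y]
    (T : X →L[ℝ] Y) (hT : IsCompactOperator T) (F : Ultrafilter ι) (u : ι → X) (r : ℝ)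
    (hu : ∀ i, ‖u i‖ ≤ r) :
    ∃ x₀ : X, (∀ f : X →L[ℝ] ℝ, Tendsto (fun i => f (u i)) F (nhds (f x₀))) ∧
      Tendsto (fun i => T (u i)) F (nhds (T x₀)) := by
  obtain ⟨x₀, hx₀⟩ := exists_forall_tendsto_of_norm_le F u r hu
  have hcpt : IsCompact (closure (T '' Metric.closedBall 0 r)) :=
    hT.isCompact_closure_image_closedBall (f := (T : X →ₗ[ℝ] Y)) r
  obtain ⟨y, -, hy⟩ := hcpt.ultrafilter_le_nhds (F.map fun i => T (u i)) (by
    rw [le_principal_iff]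
    refine Filter.mem_map.2 (Filter.univ_mem' fun i => ?_)
    exact subset_closure ⟨u i, by simpa using hu i, rfl⟩)
  have hy' : Tendsto (fun i => T (u i)) F (nhds y) := hy
  have hyT : y = T x₀ := by
    refine (SeparatingDual.eq_iff_forall_dual_eq (R := ℝ)).2 fun g => ?_
    exact tendsto_nhds_unique ((g.continuous.tendsto y).comp hy') (hx₀ (g.comp T))
  exact ⟨x₀, hx₀, hyT ▸ hy'⟩

/-- exact penalization, Step 2 of the proof of the paper's Theorem 3.1.
If the shape hessian `ℓ = ℓ_m + ℓ_r` is positive on the kernel `V` of the constraint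
functionals `L_i ∘ T`, then adding a large multiple of the squared constraint terms makes
`ℓ` coercive on the whole space. -/
theorem statement1
    {X : Type*} [NormedAddCommGroup X] [InnerProductSpace ℝ X] [CompleteSpace X]
    {Y : Type*} [NormedAddCommGroup Y] [NormedSpace ℝ Y]
    (T : X →L[ℝ] Y) (hTinj : Function.Injective T) (hTcomp : IsCompactOperator T)
    (p : Seminorm ℝ X) (hpcont : Continuous p)
    (hpT : ∀ x : X, ‖x‖ ^ 2 ≤ p x ^ 2 + ‖T x‖ ^ 2)
    (ℓm : X →L[ℝ] X →L[ℝ] ℝ) (hsymm : ∀ x y : X, ℓm x y = ℓm y x)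
    (hlsc : ∀ (u : ℕ → X) (x₀ : X),
      (∀ f : X →L[ℝ] ℝ, Tendsto (fun n => f (u n)) atTop (nhds (f x₀))) →
      ℓm x₀ x₀ ≤ liminf (fun n => ℓm (u n) (u n)) atTop)
    (C₁ : ℝ) (hC₁ : 0 < C₁) (hcoer : ∀ x : X, C₁ * p x ^ 2 ≤ ℓm x x)
    (b : Y →L[ℝ] Y →L[ℝ] ℝ)
    (ℓ : X → X → ℝ) (hℓ : ∀ x y : X, ℓ x y = ℓm x y + b (T x) (T y))
    (N : ℕ) (L : Fin N → Y →L[ℝ] ℝ)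
    (V : Set X) (hVdef : V = {x : X | ∀ i : Fin N, L i (T x) = 0})
    (hpos : ∀ x ∈ V, x ≠ 0 → 0 < ℓ x x) :
    ∃ C₀ > (0:ℝ), ∃ lam > (0:ℝ), ∀ x : X,
      lam * ‖x‖ ^ 2 ≤ ℓ x x + C₀ * ∑ i : Fin N, (L i (T x)) ^ 2 := by
  have hℓm0 : ∀ x : X, 0 ≤ ℓm x x := fun x => le_trans (by positivity) (hcoer x)
  by_contra! hcon
  have hseq : ∀ n : ℕ, ∃ u : X, ‖u‖ = 1 ∧
      ℓm u u + b (T u) (T u) + (n + 1 : ℝ) * ∑ i : Fin N, (L i (T u)) ^ 2 ≤ 1 / (n + 1 : ℝ) := by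
    intro n
    obtain ⟨x, hx⟩ := hcon (n + 1) (by positivity) (1 / (n + 1)) (by positivity)
    have hx0 : x ≠ 0 := by
      rintro rfl
      simp [hℓ] at hx
    have hn : 0 < ‖x‖ := norm_pos_iff.2 hx0
    refine ⟨‖x‖⁻¹ • x, by rw [norm_smul, norm_inv, norm_norm, inv_mul_cancel₀ hn.ne'], ?_⟩
    rw [hℓ] at hx
    simp only [map_smul, smul_apply, smul_eq_mul, mul_pow, ← Finset.mul_sum]
    have hmul := mul_le_mul_of_nonneg_left hx.le (sq_nonneg ‖x‖⁻¹)
    have hright : ‖x‖⁻¹ ^ 2 * (1 / (n + 1 : ℝ) * ‖x‖ ^ 2) = 1 / (n + 1 : ℝ) := by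
      field_simp
    rw [hright] at hmul
    linarith
  choose u hu1 hu using hseq
  let F : Ultrafilter ℕ := hyperfilter ℕ
  have hF : (F : Filter ℕ) ≤ atTop := Nat.hyperfilter_le_atTop
  obtain ⟨x₀, hweak, hT⟩ := exists_weak_limit_tendsto_map T hTcomp F u 1 fun n => (hu1 n).le
  have hε : Tendsto (fun n : ℕ => 1 / (n + 1 : ℝ)) F (nhds 0) :=
    tendsto_one_div_add_atTop_nhds_zero_nat.mono_left hF
  have hb : Tendsto (fun n => b (T (u n)) (T (u n))) F (nhds (b (T x₀) (T x₀))) :=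
    ((b.continuous.clm_apply continuous_id).tendsto (T x₀)).comp hT
  have hL : Tendsto (fun n => ∑ i : Fin N, (L i (T (u n))) ^ 2) F
      (nhds (∑ i : Fin N, (L i (T x₀)) ^ 2)) :=
    tendsto_finsetSum _ fun i _ => (((L i).continuous.tendsto _).comp hT).pow 2
  have hS : ∀ n, 0 ≤ ∑ i : Fin N, (L i (T (u n))) ^ 2 := fun n =>
    Finset.sum_nonneg fun i _ => sq_nonneg _
  have hrhs := hε.sub hb
  have hmain : ∀ n : ℕ, ℓm (u n) (u n) ≤ 1 / (n + 1 : ℝ) - b (T (u n)) (T (u n)) := by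
    intro n
    have := mul_nonneg (by positivity : (0 : ℝ) ≤ n + 1) (hS n)
    linarith [hu n]
  have hsum : ∑ i : Fin N, (L i (T x₀)) ^ 2 ≤ 0 := by
    have hlim := hε.mul hrhs
    rw [zero_mul] at hlim
    refine le_of_tendsto_of_tendsto' hL hlim fun n => ?_
    rw [one_div, inv_mul_eq_div, le_div_iff₀ (by positivity), ← one_div]
    linarith [hu n, hℓm0 (u n)]
  have hV : x₀ ∈ V := by
    rw [hVdef]
    intro i
    have := Finset.single_le_sum (f := fun i => (L i (T x₀)) ^ 2)
      (fun i _ => sq_nonneg _) (Finset.mem_univ i)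
    exact pow_eq_zero_iff two_ne_zero |>.1 (le_antisymm (this.trans hsum) (sq_nonneg _))
  have hle : ℓ x₀ x₀ ≤ 0 := by
    have hlow := ((hweak (ℓm x₀)).const_mul 2).sub_const (ℓm x₀ x₀)
    have := le_of_tendsto_of_tendsto' hlow hrhs fun n => by
      have h0 := hℓm0 (u n - x₀)
      simp only [map_sub, sub_apply] at h0
      rw [hsymm (u n) x₀] at h0
      linarith [hmain n]
    rw [hℓ]
    linarith
  have hx₀ : x₀ = 0 := by
    by_contra hne
    exact (hpos x₀ hV hne).not_ge hle
  have hone : ∀ n : ℕ, C₁ ≤ 1 / (n + 1 : ℝ) - b (T (u n)) (T (u n)) + C₁ * ‖T (u n)‖ ^ 2 := by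
    intro n
    have h := mul_le_mul_of_nonneg_left (hpT (u n)) hC₁.le
    rw [hu1 n] at h
    linarith [hcoer (u n), hmain n]
  have hC := ge_of_tendsto' (hrhs.add ((hT.norm.pow 2).const_mul C₁)) hone
  simp only [hx₀, map_zero, norm_zero] at hC
  norm_num at hC
  linarith
end

section
/- Let d ≥ 3 be an integer, 0 < ε < 1, and let u(x) = [(ε^{d−2} − ε^{d}) ‖x‖^{2−d} + ε^{d} − 1] / (2d (ε^{d−2} − 1)) − ‖x‖²/(2d) on the annulus Ω_ε = {x ∈ ℝ^d : ε < ‖x‖ < 1}. Then −(1/2) ∫_{Ω_ε} u(x) dx = [ (d(1 − ε²)² ε^{d−2} − 2(1 − ε^{d})²)/(8d²(1 − ε^{d−2})) + (1 − ε^{d+2})/(4d(d+2)) ] · d ω_d, where ω_d denotes the Lebesgue measure of the open unit ball in ℝ^d. -/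
open MeasureTheory

/-- Integration in polar coordinates of a radial function over an annulus centred at the origin. -/
theorem setIntegral_annulus_fun_norm {E : Type*} [NormedAddCommGroup E] [NormedSpace ℝ E]
    [FiniteDimensional ℝ E] [Nontrivial E] [MeasurableSpace E] [BorelSpace E]
    (μ : Measure E) [μ.IsAddHaarMeasure] {a b : ℝ} (ha : 0 ≤ a) (hab : a ≤ b) (f : ℝ → ℝ) :
    ∫ x in {x : E | a < ‖x‖ ∧ ‖x‖ < b}, f ‖x‖ ∂μ =
      Module.finrank ℝ E * μ.real (Metric.ball 0 1) *
        ∫ r in a..b, r ^ (Module.finrank ℝ E - 1) * f r := by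
  have hmeas : MeasurableSet {x : E | a < ‖x‖ ∧ ‖x‖ < b} :=
    measurable_norm measurableSet_Ioo
  have hind : {x : E | a < ‖x‖ ∧ ‖x‖ < b}.indicator (fun x => f ‖x‖) =
      fun x => (Set.Ioo a b).indicator f ‖x‖ := rfl
  rw [← integral_indicator hmeas, hind, integral_fun_norm_addHaar μ ((Set.Ioo a b).indicator f),
    intervalIntegral.integral_of_le hab, integral_Ioc_eq_integral_Ioo]
  have hmul : (fun r : ℝ => r ^ (Module.finrank ℝ E - 1) • (Set.Ioo a b).indicator f r) =
      (Set.Ioo a b).indicator (fun r => r ^ (Module.finrank ℝ E - 1) * f r) := by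
    ext r
    by_cases hr : r ∈ Set.Ioo a b <;> simp [hr]
  rw [hmul, setIntegral_indicator measurableSet_Ioo,
    Set.inter_eq_right.mpr fun r (hr : r ∈ Set.Ioo a b) => Set.mem_Ioi.2 (ha.trans_lt hr.1)]
  simp [mul_assoc]

/-- the Dirichlet energy of the annulus `Ω_ε = {ε < ‖x‖ < 1} ⊆ ℝ^d`, `d ≥ 3`,
computed from its explicit torsion function `u`:
`−(1/2)∫_{Ω_ε} u = [ (d(1−ε²)²ε^{d−2} − 2(1−ε^d)²)/(8d²(1−ε^{d−2})) + (1−ε^{d+2})/(4d(d+2)) ]·d·ω_d`. -/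
theorem statement6 (d : ℕ) (hd : 3 ≤ d) (ε : ℝ) (hε0 : 0 < ε) (hε1 : ε < 1)
    (u : EuclideanSpace ℝ (Fin d) → ℝ)
    (hu : ∀ x : EuclideanSpace ℝ (Fin d), x ≠ 0 →
      u x = ((ε ^ (d - 2) - ε ^ d) * ‖x‖ ^ ((2:ℝ) - d) + ε ^ d - 1) /
              (2 * d * (ε ^ (d - 2) - 1)) - ‖x‖ ^ 2 / (2 * d))
    (ω : ℝ) (hω : ω = (volume (Metric.ball (0 : EuclideanSpace ℝ (Fin d)) 1)).toReal) :
    -(1/2) * ∫ x in {x : EuclideanSpace ℝ (Fin d) | ε < ‖x‖ ∧ ‖x‖ < 1}, u x =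
      ((d * (1 - ε ^ 2) ^ 2 * ε ^ (d - 2) - 2 * (1 - ε ^ d) ^ 2) /
          (8 * d ^ 2 * (1 - ε ^ (d - 2))) +
        (1 - ε ^ (d + 2)) / (4 * d * (d + 2))) * (d * ω) := by
  obtain ⟨n, rfl⟩ : ∃ n, d = n + 3 := ⟨d - 3, by omega⟩
  simp only [show n + 3 - 2 = n + 1 from rfl] at hu ⊢
  have hmeas : MeasurableSet
      {x : EuclideanSpace ℝ (Fin (n + 3)) | ε < ‖x‖ ∧ ‖x‖ < 1} :=
    measurable_norm measurableSet_Ioo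
  have hpow : 1 - ε ^ (n + 1) ≠ 0 := (sub_pos.2 (pow_lt_one₀ hε0.le hε1 n.succ_ne_zero)).ne'
  set D : ℝ := 2 * ((n + 3 : ℕ) : ℝ) * (ε ^ (n + 1) - 1) with hD
  have hradial : ∫ r in ε..1, r ^ (n + 2) *
      (((ε ^ (n + 1) - ε ^ (n + 3)) * r ^ ((2 : ℝ) - (n + 3 : ℕ)) + ε ^ (n + 3) - 1) / D
        - r ^ 2 / (2 * (n + 3 : ℕ))) =
      ∫ r in ε..1, ((ε ^ (n + 1) - ε ^ (n + 3)) / D * r + (ε ^ (n + 3) - 1) / D * r ^ (n + 2)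
        - 1 / (2 * (n + 3 : ℕ)) * r ^ (n + 4)) := by
    refine intervalIntegral.integral_congr fun r hr => ?_
    rw [Set.uIcc_of_le hε1.le] at hr
    have hr0 : 0 < r := hε0.trans_le hr.1
    have hrpow : r ^ (n + 2) * r ^ ((2 : ℝ) - (n + 3 : ℕ)) = r := by
      rw [← Real.rpow_natCast, ← Real.rpow_add hr0]
      convert Real.rpow_one r using 2
      push_cast
      ring
    linear_combination (ε ^ (n + 1) - ε ^ (n + 3)) / D * hrpow
  rw [setIntegral_congr_fun hmeas fun x hx => hu x (norm_pos_iff.1 (hε0.trans hx.1)),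
    setIntegral_annulus_fun_norm volume hε0.le hε1.le fun r =>
      ((ε ^ (n + 1) - ε ^ (n + 3)) * r ^ ((2 : ℝ) - (n + 3 : ℕ)) + ε ^ (n + 3) - 1) / D
        - r ^ 2 / (2 * (n + 3 : ℕ)),
    finrank_euclideanSpace_fin, show n + 3 - 1 = n + 2 from rfl, hradial,
    intervalIntegral.integral_sub (Continuous.intervalIntegrable (by fun_prop) _ _)
      (Continuous.intervalIntegrable (by fun_prop) _ _),
    intervalIntegral.integral_add (Continuous.intervalIntegrable (by fun_prop) _ _)
      (Continuous.intervalIntegrable (by fun_prop) _ _),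
    intervalIntegral.integral_const_mul, intervalIntegral.integral_const_mul,
    intervalIntegral.integral_const_mul, integral_id, integral_pow, integral_pow,
    measureReal_def, ← hω, hD, show ε ^ (n + 1) - 1 = -(1 - ε ^ (n + 1)) by ring]
  push_cast
  rw [show (n : ℝ) + 2 + 1 = n + 3 by ring, show (n : ℝ) + 4 + 1 = n + 5 by ring,
    show (n : ℝ) + 3 + 2 = n + 5 by ring]
  field_simp
  ring
end

section
/- Let d ≥ 3 be an integer and define, for ε ∈ (0,1), f(ε) = (d(1 − ε²)² ε^{d−2} − 2(1 − ε^{d})²)/(8d²(1 − ε^{d−2})) + (1 − ε^{d+2})/(4d(d+2)). Then, as ε → 0⁺, f(ε) = −1/(2d²(d+2)) + ((d−2)/(8d²)) ε^{d−2} + o(ε^{d−2}); that is, the function ε ↦ f(ε) + 1/(2d²(d+2)) − ((d−2)/(8d²)) ε^{d−2} is o(ε^{d−2}) as ε → 0⁺. -/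
open Filter Asymptotics

/-- asymptotic expansion of the (normalized) Dirichlet energy of the annulus
`Ω_ε ⊆ ℝ^d`, `d ≥ 3`:
`f(ε) = −1/(2d²(d+2)) + ((d−2)/(8d²)) ε^{d−2} + o(ε^{d−2})` as `ε → 0⁺`. -/
theorem statement8 (d : ℕ) (hd : 3 ≤ d) (f : ℝ → ℝ)
    (hf : ∀ ε : ℝ, 0 < ε → ε < 1 →
      f ε = (d * (1 - ε ^ 2) ^ 2 * ε ^ (d - 2) - 2 * (1 - ε ^ d) ^ 2) /
              (8 * d ^ 2 * (1 - ε ^ (d - 2))) +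
            (1 - ε ^ (d + 2)) / (4 * d * (d + 2))) :
    (fun ε : ℝ => f ε + 1 / (2 * d ^ 2 * (d + 2)) - (d - 2) / (8 * d ^ 2) * ε ^ (d - 2))
      =o[nhdsWithin 0 (Set.Ioi (0:ℝ))] (fun ε : ℝ => ε ^ (d - 2)) := by
  obtain ⟨n, rfl⟩ : ∃ n, d = n + 2 := ⟨d - 2, by omega⟩
  have hn : n ≠ 0 := by omega
  simp only [Nat.add_sub_cancel] at hf ⊢
  set D : ℝ := ((n + 2 : ℕ) : ℝ) with hD
  have hD0 : 0 < D := by positivity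
  rw [isLittleO_iff_exists_eq_mul]
  refine ⟨fun x => (D * (1 - x ^ 2) ^ 2 + 4 * x ^ 2 - 2 * x ^ n * x ^ 4 - 2
      - (D - 2) * (1 - x ^ n)) / (8 * D ^ 2 * (1 - x ^ n)) - x ^ 4 / (4 * D * (D + 2)), ?_, ?_⟩
  · refine Tendsto.mono_left ?_ nhdsWithin_le_nhds
    refine (ContinuousAt.tendsto (x := (0 : ℝ)) ?_).trans (le_of_eq (congrArg nhds ?_))
    · refine ContinuousAt.sub (ContinuousAt.div (by fun_prop) (by fun_prop) ?_) (by fun_prop)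
      simp [hn, hD0.ne']
    · simp [hn]
  · filter_upwards [Ioo_mem_nhdsGT (zero_lt_one' ℝ)] with x hx
    have ht : 1 - x ^ n ≠ 0 := (sub_pos.2 (pow_lt_one₀ hx.1.le hx.2 hn)).ne'
    have hD2 : D + 2 ≠ 0 := by positivity
    simp only [Pi.mul_apply]
    rw [hf x hx.1 hx.2, pow_add x n 2, show n + 2 + 2 = n + 4 by rfl, pow_add x n 4]
    generalize x ^ n = t at ht ⊢
    field_simp
    ring
end

section
/- Define, for ε ∈ (0,1), f₂(ε) = (1 − ε²)(1 − ε²(1 − 2 log ε))/(−32 log ε) − (1 − ε²)²/32. Then, as ε → 0⁺, f₂(ε) + 1/32 is asymptotically equivalent to −1/(32 log ε); that is, (f₂(ε) + 1/32) / (−1/(32 log ε)) → 1 as ε → 0⁺. In particular f₂(ε) + 1/32 > 0 for all sufficiently small ε > 0. -/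
open Filter

/-- asymptotic expansion for the planar annulus: `f₂(ε) + 1/32` is
asymptotically equivalent to `−1/(32 log ε)` as `ε → 0⁺`; in particular it is positive for
all sufficiently small `ε > 0`. -/
theorem statement9 (f₂ : ℝ → ℝ)
    (hf₂ : ∀ ε : ℝ, 0 < ε → ε < 1 →
      f₂ ε = (1 - ε ^ 2) * (1 - ε ^ 2 * (1 - 2 * Real.log ε)) / (-32 * Real.log ε) -
             (1 - ε ^ 2) ^ 2 / 32) :
    Tendsto (fun ε : ℝ => (f₂ ε + 1 / 32) / (-1 / (32 * Real.log ε)))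
        (nhdsWithin 0 (Set.Ioi (0:ℝ))) (nhds 1) ∧
    ∃ ε₀ > (0:ℝ), ∀ ε : ℝ, 0 < ε → ε < ε₀ → 0 < f₂ ε + 1 / 32 := by
  have hcont : Continuous fun ε : ℝ =>
      (1 - ε ^ 2) * (1 - ε ^ 2 + 2 * ε * (ε * Real.log ε)) -
        (2 * ε - ε ^ 3) * (ε * Real.log ε) := by
    have h := Real.continuous_mul_log
    fun_prop
  have hlim : Tendsto (fun ε : ℝ => (f₂ ε + 1 / 32) / (-1 / (32 * Real.log ε)))
      (nhdsWithin 0 (Set.Ioi (0:ℝ))) (nhds 1) := by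
    have h0 := (hcont.tendsto 0).mono_left (nhdsWithin_le_nhds (s := Set.Ioi (0:ℝ)))
    norm_num at h0
    refine h0.congr' ?_
    filter_upwards [Ioo_mem_nhdsGT (zero_lt_one' ℝ)] with ε hε
    have hlog : Real.log ε ≠ 0 := (Real.log_neg hε.1 hε.2).ne
    rw [hf₂ ε hε.1 hε.2]
    field_simp
    ring
  refine ⟨hlim, ?_⟩
  have hpos := hlim.eventually (lt_mem_nhds (zero_lt_one' ℝ))
  obtain ⟨δ, hδ, hsub⟩ := mem_nhdsGT_iff_exists_Ioo_subset.mp hpos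
  refine ⟨min δ 1, lt_min hδ zero_lt_one, fun ε hε hlt => ?_⟩
  have hquot : 0 < (f₂ ε + 1 / 32) / (-1 / (32 * Real.log ε)) :=
    hsub ⟨hε, hlt.trans_le (min_le_left _ _)⟩
  have hlog : Real.log ε < 0 := Real.log_neg hε (hlt.trans_le (min_le_right _ _))
  have hden : 0 < -1 / (32 * Real.log ε) :=
    div_pos_of_neg_of_neg (by norm_num) (by linarith)
  exact (div_pos_iff_of_pos_right hden).mp hquot
end

section
/- Let d ≥ 3 be an integer, μ_ε = (1 − ε^{d})^{−1/d}, and f(ε) = (d(1 − ε²)² ε^{d−2} − 2(1 − ε^{d})²)/(8d²(1 − ε^{d−2})) + (1 − ε^{d+2})/(4d(d+2)) for ε ∈ (0,1). Then, as ε → 0⁺, μ_ε^{d+2} f(ε) + 1/(2d²(d+2)) is asymptotically equivalent to ((d−2)/(8d²)) ε^{d−2}; in particular this quantity is positive for all sufficiently small ε > 0. -/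
open Filter

/-- The difference quotient `((1 - x) ^ p - 1) / x` tends to `-p` as `x → 0`. -/
theorem tendsto_one_sub_rpow_sub_one_div (p : ℝ) :
    Tendsto (fun x : ℝ => ((1 - x) ^ p - 1) / x) (nhdsWithin 0 {0}ᶜ) (nhds (-p)) := by
  have h : HasDerivAt (fun x : ℝ => (1 - x) ^ p) (-p) 0 := by
    have := ((hasDerivAt_id (0 : ℝ)).const_sub 1).rpow_const (p := p) (by simp)
    simpa using this
  have h' := hasDerivAt_iff_tendsto_slope_zero.1 h
  refine h'.congr fun x => ?_
  simp [div_eq_inv_mul]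

/-- The algebraic identity isolating the factor `t = ε ^ (d - 2)` in the normalized energy. -/
theorem energy_ratio_eq {d t e M : ℝ} (hd : 2 < d) (ht : 0 < t) (ht1 : t < 1) (he : 0 < e) :
    (M * ((d * (1 - e ^ 2) ^ 2 * t - 2 * (1 - t * e ^ 2) ^ 2) / (8 * d ^ 2 * (1 - t)) +
        (1 - t * e ^ 4) / (4 * d * (d + 2))) + 1 / (2 * d ^ 2 * (d + 2))) /
      ((d - 2) / (8 * d ^ 2) * t) =
    ((M - 1) / (t * e ^ 2) * e ^ 2 *
      ((d * (1 - e ^ 2) ^ 2 * t - 2 * (1 - t * e ^ 2) ^ 2) / (8 * d ^ 2 * (1 - t)) +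
        (1 - t * e ^ 4) / (4 * d * (d + 2))) +
      ((d * (1 - e ^ 2) ^ 2 + 4 * e ^ 2 - 2 * e ^ 4 * t - 2) / (8 * d ^ 2 * (1 - t)) -
        e ^ 4 / (4 * d * (d + 2)))) / ((d - 2) / (8 * d ^ 2)) := by
  have h1 : 1 - t ≠ 0 := by linarith
  have h2 : d - 2 ≠ 0 := by linarith
  have h3 : d + 2 ≠ 0 := by linarith
  have h4 : d ≠ 0 := by linarith
  field_simp
  ring

/-- the relative Dirichlet-energy increase of the volume-normalized annulus
in `ℝ^d`, `d ≥ 3`, namely `μ_ε^{d+2} f(ε) + 1/(2d²(d+2))`, is asymptotically equivalent to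
`((d−2)/(8d²)) ε^{d−2}` as `ε → 0⁺`; in particular it is positive for small `ε > 0`. -/
theorem statement12 (d : ℕ) (hd : 3 ≤ d) (μ f : ℝ → ℝ)
    (hμ : ∀ ε : ℝ, 0 < ε → ε < 1 → μ ε = (1 - ε ^ d) ^ (-(1:ℝ) / d))
    (hf : ∀ ε : ℝ, 0 < ε → ε < 1 →
      f ε = (d * (1 - ε ^ 2) ^ 2 * ε ^ (d - 2) - 2 * (1 - ε ^ d) ^ 2) /
              (8 * d ^ 2 * (1 - ε ^ (d - 2))) +
            (1 - ε ^ (d + 2)) / (4 * d * (d + 2))) :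
    Tendsto (fun ε : ℝ =>
        ((μ ε) ^ (d + 2) * f ε + 1 / (2 * d ^ 2 * (d + 2))) / ((d - 2) / (8 * d ^ 2) * ε ^ (d - 2)))
      (nhdsWithin 0 (Set.Ioi (0:ℝ))) (nhds 1) ∧
    ∃ ε₀ > (0:ℝ), ∀ ε : ℝ, 0 < ε → ε < ε₀ →
      0 < (μ ε) ^ (d + 2) * f ε + 1 / (2 * d ^ 2 * (d + 2)) := by
  have hdR : (2 : ℝ) < d := by exact_mod_cast hd
  have hd0 : (d : ℝ) ≠ 0 := by linarith
  have hd2 : (d : ℝ) - 2 ≠ 0 := by linarith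
  have hk : d - 2 ≠ 0 := by omega
  have hpow : ∀ ε : ℝ, ε ^ d = ε ^ (d - 2) * ε ^ 2 := fun ε => by
    rw [← pow_add]; congr 1; omega
  have hpow' : ∀ ε : ℝ, ε ^ (d + 2) = ε ^ (d - 2) * ε ^ 4 := fun ε => by
    rw [← pow_add]; congr 1; omega
  have hsmall : ∀ᶠ ε : ℝ in nhdsWithin 0 (Set.Ioi 0), ε ∈ Set.Ioo (0 : ℝ) 1 :=
    Ioo_mem_nhdsGT one_pos
  set p : ℝ := -(1 : ℝ) / d * ((d + 2 : ℕ) : ℝ) with hp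
  have hM : Tendsto (fun ε : ℝ => ((1 - ε ^ (d - 2) * ε ^ 2) ^ p - 1) / (ε ^ (d - 2) * ε ^ 2))
      (nhdsWithin 0 (Set.Ioi 0)) (nhds (-p)) := by
    refine (tendsto_one_sub_rpow_sub_one_div p).comp
      (tendsto_nhdsWithin_iff.2 ⟨?_, ?_⟩)
    · have : Continuous fun ε : ℝ => ε ^ (d - 2) * ε ^ 2 := by fun_prop
      simpa [hk] using (this.tendsto 0).mono_left nhdsWithin_le_nhds
    · filter_upwards [hsmall] with ε hε
      have := hε.1
      exact (by positivity : ε ^ (d - 2) * ε ^ 2 ≠ 0)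
  have hF : ContinuousAt (fun ε : ℝ =>
      (d * (1 - ε ^ 2) ^ 2 * ε ^ (d - 2) - 2 * (1 - ε ^ (d - 2) * ε ^ 2) ^ 2) /
        (8 * (d : ℝ) ^ 2 * (1 - ε ^ (d - 2))) +
        (1 - ε ^ (d - 2) * ε ^ 4) / (4 * (d : ℝ) * (d + 2))) 0 := by
    refine (ContinuousAt.div (by fun_prop) (by fun_prop) ?_).add (by fun_prop)
    simp [hk, hd0]
  have hG : ContinuousAt (fun ε : ℝ =>
      (d * (1 - ε ^ 2) ^ 2 + 4 * ε ^ 2 - 2 * ε ^ 4 * ε ^ (d - 2) - 2) /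
        (8 * (d : ℝ) ^ 2 * (1 - ε ^ (d - 2))) - ε ^ 4 / (4 * (d : ℝ) * (d + 2))) 0 := by
    refine (ContinuousAt.div (by fun_prop) (by fun_prop) ?_).sub (by fun_prop)
    simp [hk, hd0]
  have hE : Tendsto (fun ε : ℝ => ε ^ 2) (nhdsWithin 0 (Set.Ioi 0)) (nhds (0 ^ 2)) :=
    ((continuous_pow 2).tendsto (0 : ℝ)).mono_left nhdsWithin_le_nhds
  have hlim : Tendsto (fun ε : ℝ =>
      ((μ ε) ^ (d + 2) * f ε + 1 / (2 * d ^ 2 * (d + 2))) / ((d - 2) / (8 * d ^ 2) * ε ^ (d - 2)))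
      (nhdsWithin 0 (Set.Ioi (0:ℝ))) (nhds 1) := by
    have key := (((hM.mul hE).mul (hF.tendsto.mono_left nhdsWithin_le_nhds)).add
      (hG.tendsto.mono_left nhdsWithin_le_nhds)).div_const (((d : ℝ) - 2) / (8 * d ^ 2))
    have hval : ((d : ℝ) - 2) / (8 * d ^ 2) ≠ 0 := by positivity
    simp only [ne_eq, OfNat.ofNat_ne_zero, not_false_eq_true, zero_pow, hk, mul_zero, zero_mul,
      zero_add, sub_zero, one_pow, mul_one, add_zero, zero_div, div_self hval] at key
    refine key.congr' ?_
    filter_upwards [hsmall] with ε hε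
    have hMε : μ ε ^ (d + 2) = (1 - ε ^ (d - 2) * ε ^ 2) ^ p := by
      have h0 : 0 ≤ 1 - ε ^ d := sub_nonneg.2 (pow_le_one₀ hε.1.le hε.2.le)
      rw [hμ ε hε.1 hε.2, ← Real.rpow_natCast, ← Real.rpow_mul h0, hpow]
    rw [hf ε hε.1 hε.2, hMε, hpow, hpow']
    exact (energy_ratio_eq hdR (pow_pos hε.1 _) (pow_lt_one₀ hε.1.le hε.2 hk) hε.1).symm
  refine ⟨hlim, ?_⟩
  obtain ⟨ε₀, hε₀, h⟩ := mem_nhdsGT_iff_exists_Ioo_subset.1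
    (hlim.eventually (lt_mem_nhds one_pos))
  refine ⟨ε₀, hε₀, fun ε h0 h1 => ?_⟩
  have hden : 0 < ((d : ℝ) - 2) / (8 * d ^ 2) * ε ^ (d - 2) := by
    have : 0 < (d : ℝ) - 2 := by linarith
    positivity
  exact (div_pos_iff_of_pos_right hden).1 (h ⟨h0, h1⟩)
end

section
/- Set μ_ε = (1 − ε²)^{−1/2} and f₂(ε) = (1 − ε²)(1 − ε²(1 − 2 log ε))/(−32 log ε) − (1 − ε²)²/32 for ε ∈ (0,1). Then, as ε → 0⁺, μ_ε⁴ f₂(ε) + 1/32 is asymptotically equivalent to −1/(32 log ε); in particular this quantity is positive for all sufficiently small ε > 0. -/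
open Filter

/-- The fourth power of `a ^ (-1/2)` is the inverse square of `a`. -/
lemma rpow_neg_half_pow_four {a : ℝ} (ha : 0 < a) : (a ^ (-(1:ℝ) / 2)) ^ 4 = (a ^ 2)⁻¹ := by
  rw [← Real.rpow_natCast, ← Real.rpow_mul ha.le, ← Real.rpow_natCast a 2, ← Real.rpow_neg ha.le]
  norm_num

lemma tendsto_annulus_ratio :
    Tendsto (fun ε : ℝ => (1 - ε ^ 2 * (1 - 2 * Real.log ε)) / (1 - ε ^ 2))
      (nhdsWithin 0 (Set.Ioi (0:ℝ))) (nhds 1) := by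
  have hnum : Continuous fun ε : ℝ => 1 - ε ^ 2 * (1 - 2 * Real.log ε) := by
    have h : Continuous fun ε : ℝ => 1 - ε ^ 2 + 2 * ε * (ε * Real.log ε) :=
      (by fun_prop : Continuous fun ε : ℝ => 1 - ε ^ 2).add
        ((by fun_prop : Continuous fun ε : ℝ => 2 * ε).mul Real.continuous_mul_log)
    convert h using 2
    ring
  have hden : Continuous fun ε : ℝ => 1 - ε ^ 2 := by fun_prop
  have h : Tendsto (fun ε : ℝ => (1 - ε ^ 2 * (1 - 2 * Real.log ε)) / (1 - ε ^ 2))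
      (nhds 0) (nhds ((1 - 0 ^ 2 * (1 - 2 * Real.log 0)) / (1 - 0 ^ 2))) :=
    (hnum.tendsto 0).div (hden.tendsto 0) (by norm_num)
  norm_num at h
  exact h.mono_left nhdsWithin_le_nhds

/-- in dimension 2, the relative Dirichlet-energy increase of the
area-normalized annulus, `μ_ε⁴ f₂(ε) + 1/32` with `μ_ε = (1 − ε²)^{−1/2}`, is asymptotically
equivalent to `−1/(32 log ε)` as `ε → 0⁺`; in particular it is positive for small `ε > 0`. -/
theorem statement13 (μ f₂ : ℝ → ℝ)
    (hμ : ∀ ε : ℝ, 0 < ε → ε < 1 → μ ε = (1 - ε ^ 2) ^ (-(1:ℝ) / 2))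
    (hf₂ : ∀ ε : ℝ, 0 < ε → ε < 1 →
      f₂ ε = (1 - ε ^ 2) * (1 - ε ^ 2 * (1 - 2 * Real.log ε)) / (-32 * Real.log ε) -
             (1 - ε ^ 2) ^ 2 / 32) :
    Tendsto (fun ε : ℝ => ((μ ε) ^ 4 * f₂ ε + 1 / 32) / (-1 / (32 * Real.log ε)))
      (nhdsWithin 0 (Set.Ioi (0:ℝ))) (nhds 1) ∧
    ∃ ε₀ > (0:ℝ), ∀ ε : ℝ, 0 < ε → ε < ε₀ → 0 < (μ ε) ^ 4 * f₂ ε + 1 / 32 := by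
  have ratio_eq : ∀ ε : ℝ, 0 < ε → ε < 1 →
      ((μ ε) ^ 4 * f₂ ε + 1 / 32) / (-1 / (32 * Real.log ε)) =
        (1 - ε ^ 2 * (1 - 2 * Real.log ε)) / (1 - ε ^ 2) := by
    intro ε h0 h1
    have ha : 0 < 1 - ε ^ 2 := by nlinarith
    have hL : Real.log ε ≠ 0 := (Real.log_neg h0 h1).ne
    rw [hμ ε h0 h1, hf₂ ε h0 h1, rpow_neg_half_pow_four ha]
    generalize Real.log ε = L at hL ⊢
    have ha' := ha.ne'
    field_simp
    ring
  have small : ∀ᶠ ε : ℝ in nhdsWithin 0 (Set.Ioi 0), 0 < ε ∧ ε < 1 :=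
    Ioo_mem_nhdsGT one_pos
  have lim : Tendsto (fun ε : ℝ => ((μ ε) ^ 4 * f₂ ε + 1 / 32) / (-1 / (32 * Real.log ε)))
      (nhdsWithin 0 (Set.Ioi (0:ℝ))) (nhds 1) :=
    tendsto_annulus_ratio.congr' (small.mono fun ε h => (ratio_eq ε h.1 h.2).symm)
  refine ⟨lim, ?_⟩
  have pos : ∀ᶠ ε : ℝ in nhdsWithin 0 (Set.Ioi 0), 0 < (μ ε) ^ 4 * f₂ ε + 1 / 32 := by
    filter_upwards [small, lim.eventually_const_lt one_pos] with ε h hr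
    have hd : 0 < -1 / (32 * Real.log ε) :=
      div_pos_of_neg_of_neg (by norm_num) (by linarith [Real.log_neg h.1 h.2])
    exact (div_pos_iff_of_pos_right hd).1 hr
  obtain ⟨ε₀, h0, h⟩ := mem_nhdsGT_iff_exists_Ioo_subset.1 pos
  exact ⟨ε₀, h0, fun ε h1 h2 => h ⟨h1, h2⟩⟩
end

section
/- Let d ≥ 3 be an integer, and for ε ∈ (0,1) set μ_ε = (1 − ε^{d})^{−1/d} and f(ε) = (d(1 − ε²)² ε^{d−2} − 2(1 − ε^{d})²)/(8d²(1 − ε^{d−2})) + (1 − ε^{d+2})/(4d(d+2)). Then for every real γ < 0 there exists ε₀ ∈ (0,1) such that for all ε ∈ (0, ε₀): (μ_ε^{d−1}(1 + ε^{d−1}) − 1) + γ · (μ_ε^{d+2} f(ε) + 1/(2d²(d+2))) < 0. -/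
/-- Elementary bounds for powers of `(1 - x) ^ (-1 / d)` with exponents `d - 1` and `d + 2`. -/
lemma rpow_neg_inv_bounds {d : ℕ} (hd : 2 ≤ d) {x : ℝ} (hx0 : 0 ≤ x) (hx : x ≤ 1 / 2) :
    ((1 - x) ^ (-(1:ℝ) / d)) ^ (d - 1) ≤ 1 + 2 * x ∧
      1 ≤ ((1 - x) ^ (-(1:ℝ) / d)) ^ (d + 2) ∧
      ((1 - x) ^ (-(1:ℝ) / d)) ^ (d + 2) ≤ 1 + 8 * x := by
  have hd0 : (d : ℝ) ≠ 0 := by positivity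
  have hpos : 0 < 1 - x := by linarith
  set m := (1 - x) ^ (-(1:ℝ) / d) with hm
  have h1 : 1 ≤ m :=
    Real.one_le_rpow_of_pos_of_le_one_of_nonpos hpos (by linarith)
      (div_nonpos_of_nonpos_of_nonneg (by norm_num) (Nat.cast_nonneg d))
  have hmd : m ^ d = (1 - x)⁻¹ := by
    rw [hm, ← Real.rpow_natCast, ← Real.rpow_mul hpos.le, div_mul_cancel₀ _ hd0,
      Real.rpow_neg_one]
  have hle : m ^ d ≤ 1 + 2 * x := by
    rw [hmd, inv_le_iff_one_le_mul₀ hpos]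
    nlinarith
  refine ⟨(pow_le_pow_right₀ h1 (Nat.sub_le d 1)).trans hle, one_le_pow₀ h1, ?_⟩
  have h2 : m ^ (d + 2) ≤ m ^ (d * 2) := pow_le_pow_right₀ h1 (by omega)
  rw [pow_mul] at h2
  have h3 : (m ^ d) ^ 2 ≤ (1 + 2 * x) ^ 2 := by gcongr
  nlinarith

/-- Lower bound, of order `t = ε ^ (d - 2)`, for the energy gap of the annulus before
normalization of the volume. -/
lemma energy_gap_lower_bound {D ε t : ℝ} (hD : 3 ≤ D) (hε0 : 0 < ε) (ht0 : 0 < t) (ht : t ≤ 1 / 2)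
    (hεD : 4 * D * ε ^ 2 ≤ 1) (hε1 : ε ≤ 1) :
    t / (16 * D ^ 2) - ε ^ 4 * t ≤
      (D * (1 - ε ^ 2) ^ 2 * t - 2 * (1 - ε ^ 2 * t) ^ 2) / (8 * D ^ 2 * (1 - t)) +
        (1 - ε ^ 4 * t) / (4 * D * (D + 2)) + 1 / (2 * D ^ 2 * (D + 2)) := by
  have h1t : 0 < 1 - t := by linarith
  have hε2 : ε ^ 2 ≤ 1 := pow_le_one₀ hε0.le hε1
  have hx0 : 0 ≤ ε ^ 2 * t := by positivity
  have hx1 : ε ^ 2 * t ≤ 1 := by nlinarith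
  have key : t / (16 * D ^ 2) ≤
      (D * (1 - ε ^ 2) ^ 2 * t - 2 * (1 - ε ^ 2 * t) ^ 2 + 2 * (1 - t)) /
        (8 * D ^ 2 * (1 - t)) := by
    rw [div_le_div_iff₀ (by positivity) (by positivity)]
    have hs : (1 - ε ^ 2 * t) ^ 2 ≤ 1 := by nlinarith
    have hq : 1 - 2 * ε ^ 2 ≤ (1 - ε ^ 2) ^ 2 := by nlinarith [sq_nonneg (ε ^ 2)]
    have hDq : 5 / 2 ≤ D * (1 - ε ^ 2) ^ 2 := by nlinarith
    have hn : t / 2 ≤ D * (1 - ε ^ 2) ^ 2 * t - 2 * (1 - ε ^ 2 * t) ^ 2 + 2 * (1 - t) := by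
      nlinarith
    calc t * (8 * D ^ 2 * (1 - t)) ≤ t * (8 * D ^ 2 * 1) := by gcongr; linarith
      _ = t / 2 * (16 * D ^ 2) := by ring
      _ ≤ _ := by gcongr
  have hlast : ε ^ 4 * t / (4 * D * (D + 2)) ≤ ε ^ 4 * t :=
    div_le_self (by positivity) (by nlinarith)
  have heq : (D * (1 - ε ^ 2) ^ 2 * t - 2 * (1 - ε ^ 2 * t) ^ 2) / (8 * D ^ 2 * (1 - t)) +
        (1 - ε ^ 4 * t) / (4 * D * (D + 2)) + 1 / (2 * D ^ 2 * (D + 2)) =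
      (D * (1 - ε ^ 2) ^ 2 * t - 2 * (1 - ε ^ 2 * t) ^ 2 + 2 * (1 - t)) /
        (8 * D ^ 2 * (1 - t)) - ε ^ 4 * t / (4 * D * (D + 2)) := by
    have : D + 2 ≠ 0 := by positivity
    have : D ≠ 0 := by positivity
    have := h1t.ne'
    field_simp
    ring
  rw [heq]
  linarith

/-- counterexample, `d ≥ 3`: for every `γ < 0`, for all small `ε > 0` the
normalized annulus satisfies `(P + γE)(Ω̃_ε) < (P + γE)(B₁)`, expressed via the explicit
values `μ_ε^{d−1}(1+ε^{d−1}) − 1` and `μ_ε^{d+2} f(ε) + 1/(2d²(d+2))`. -/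
theorem statement15 (d : ℕ) (hd : 3 ≤ d) (μ f : ℝ → ℝ)
    (hμ : ∀ ε : ℝ, 0 < ε → ε < 1 → μ ε = (1 - ε ^ d) ^ (-(1:ℝ) / d))
    (hf : ∀ ε : ℝ, 0 < ε → ε < 1 →
      f ε = (d * (1 - ε ^ 2) ^ 2 * ε ^ (d - 2) - 2 * (1 - ε ^ d) ^ 2) /
              (8 * d ^ 2 * (1 - ε ^ (d - 2))) +
            (1 - ε ^ (d + 2)) / (4 * d * (d + 2))) :
    ∀ γ : ℝ, γ < 0 → ∃ ε₀ : ℝ, 0 < ε₀ ∧ ε₀ < 1 ∧ ∀ ε : ℝ, 0 < ε → ε < ε₀ →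
      ((μ ε) ^ (d - 1) * (1 + ε ^ (d - 1)) - 1) +
        γ * ((μ ε) ^ (d + 2) * f ε + 1 / (2 * d ^ 2 * (d + 2))) < 0 := by
  intro γ hγ
  have hD : (3 : ℝ) ≤ d := by exact_mod_cast hd
  have hA : (1 : ℝ) / (288 * d ^ 2) < 1 := by
    rw [div_lt_one (by positivity)]
    nlinarith
  refine ⟨min (1 / (288 * d ^ 2)) (-γ / (160 * d ^ 2)),
    lt_min (by positivity) (div_pos (by linarith) (by positivity)),
    (min_le_left _ _).trans_lt hA, fun ε hε0 hε ↦ ?_⟩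
  obtain ⟨h₁, h₂⟩ := lt_min_iff.mp hε
  have hε1 : ε < 1 := h₁.trans hA
  have h288 : ε * (288 * d ^ 2) < 1 := (lt_div_iff₀ (by positivity)).mp h₁
  have h160 : ε * (160 * d ^ 2) < -γ := (lt_div_iff₀ (by positivity)).mp h₂
  have hεhalf : ε ≤ 1 / 2 := by nlinarith
  rw [hμ ε hε0 hε1]
  have hfε := hf ε hε0 hε1
  have e1 : ε ^ (d - 1) = ε * ε ^ (d - 2) := by rw [← pow_succ']; congr 1; omega
  have e2 : ε ^ d = ε ^ 2 * ε ^ (d - 2) := by rw [← pow_add]; congr 1; omega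
  have e3 : ε ^ (d + 2) = ε ^ 4 * ε ^ (d - 2) := by rw [← pow_add]; congr 1; omega
  have ht0 : 0 < ε ^ (d - 2) := by positivity
  have htε : ε ^ (d - 2) ≤ ε := pow_le_of_le_one hε0.le hε1.le (by omega)
  rw [e2, e3] at hfε
  rw [e1, e2]
  generalize ε ^ (d - 2) = t at *
  have hε2 : ε ^ 2 ≤ ε := by nlinarith
  have hε4 : ε ^ 4 ≤ ε := pow_le_of_le_one hε0.le hε1.le (by norm_num)
  have hx0 : 0 ≤ ε ^ 2 * t := by positivity
  have hxs : ε ^ 2 * t ≤ ε * t := by gcongr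
  have hs : ε * t ≤ 1 / 4 := by nlinarith
  obtain ⟨hP, hM1, hM⟩ := rpow_neg_inv_bounds (d := d) (by omega) hx0 (by linarith)
  have hgap := energy_gap_lower_bound hD hε0 ht0 (by linarith) (by nlinarith) hε1.le
  rw [← hfε] at hgap
  generalize ((1 - ε ^ 2 * t) ^ (-(1:ℝ) / d)) ^ (d + 2) = M at *
  generalize ((1 - ε ^ 2 * t) ^ (-(1:ℝ) / d)) ^ (d - 1) = N at *
  have hc : (1 : ℝ) / (2 * d ^ 2 * (d + 2)) ≤ 1 := by
    rw [div_le_one (by positivity)]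
    nlinarith
  generalize (1 : ℝ) / (2 * d ^ 2 * (d + 2)) = c at *
  have hk : t / (16 * (d : ℝ) ^ 2) = 2 * (1 / (32 * (d : ℝ) ^ 2)) * t := by field_simp; norm_num
  have h9 : 9 * ε ≤ 1 / (32 * (d : ℝ) ^ 2) := by
    rw [le_div_iff₀ (by positivity)]
    linarith
  have h5 : 5 * ε < -γ * (1 / (32 * (d : ℝ) ^ 2)) := by
    rw [mul_one_div, lt_div_iff₀ (by positivity)]
    linarith
  rw [hk] at hgap
  generalize (1 : ℝ) / (32 * (d : ℝ) ^ 2) = k at *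
  have hε4t : ε ^ 4 * t ≤ ε * t := by gcongr
  have h9t : 9 * ε * t ≤ k * t := by gcongr
  have hst : 0 < ε * t := by positivity
  have hf1 : -1 ≤ f ε := by linarith
  have hperim : N * (1 + ε * t) - 1 ≤ 5 * ε * t := by
    have : N * (1 + ε * t) ≤ (1 + 2 * (ε * t)) * (1 + ε * t) := by
      gcongr
      linarith
    nlinarith only [this, hs, hst]
  have hMf : -(8 * (ε ^ 2 * t)) ≤ (M - 1) * f ε := by
    have := mul_nonneg (sub_nonneg.mpr hM1) (neg_le_iff_add_nonneg.mp hf1)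
    linarith
  have henergy : k * t ≤ M * f ε + c := by linarith
  have hγE : γ * (M * f ε + c) ≤ γ * (k * t) := mul_le_mul_of_nonpos_left henergy hγ.le
  have h5t : 5 * ε * t < -γ * k * t := by gcongr
  linarith
end

section
/- For ε ∈ (0,1) set μ_ε = (1 − ε²)^{−1/2} and f₂(ε) = (1 − ε²)(1 − ε²(1 − 2 log ε))/(−32 log ε) − (1 − ε²)²/32. Then for every real γ < 0 there exists ε₀ ∈ (0,1) such that for all ε ∈ (0, ε₀): (μ_ε(1 + ε) − 1) + γ · (μ_ε⁴ f₂(ε) + 1/32) < 0. -/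
/-- The perimeter excess of the normalized annulus is at most linear in the inner radius. -/
lemma annulus_perimeter_excess_le {ε : ℝ} (h0 : 0 < ε) (h1 : ε ≤ 1 / 2) :
    (1 - ε ^ 2) ^ (-(1 : ℝ) / 2) * (1 + ε) - 1 ≤ 2 * ε := by
  have hpos : 0 < 1 - ε ^ 2 := by nlinarith
  have hsq : ((1 - ε ^ 2) ^ (-(1 : ℝ) / 2)) ^ 2 = (1 - ε ^ 2)⁻¹ := by
    rw [← Real.rpow_natCast, ← Real.rpow_mul hpos.le, ← Real.rpow_neg_one]
    norm_num
  have key : ((1 - ε ^ 2) ^ (-(1 : ℝ) / 2) * (1 + ε)) ^ 2 ≤ (1 + 2 * ε) ^ 2 := by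
    rw [mul_pow, hsq, inv_mul_le_iff₀ hpos]
    have h : 0 ≤ (1 + ε) * (ε * (2 - 4 * ε ^ 2)) := by
      have : 0 ≤ 2 - 4 * ε ^ 2 := by nlinarith
      positivity
    nlinarith [h]
  linarith [abs_le_of_sq_le_sq' key (by linarith)]

/-- The energy excess of the normalized annulus is at least of order `1 / |log ε|`. -/
lemma le_annulus_energy_excess {ε : ℝ} (h0 : 0 < ε) (h1 : ε ≤ 1 / 5) :
    1 / (64 * -Real.log ε) ≤ ((1 - ε ^ 2) ^ (-(1 : ℝ) / 2)) ^ 4 *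
      ((1 - ε ^ 2) * (1 - ε ^ 2 * (1 - 2 * Real.log ε)) / (-32 * Real.log ε) -
        (1 - ε ^ 2) ^ 2 / 32) + 1 / 32 := by
  have hpos : 0 < 1 - ε ^ 2 := by nlinarith
  have hpow : ((1 - ε ^ 2) ^ (-(1 : ℝ) / 2)) ^ 4 = ((1 - ε ^ 2) ^ 2)⁻¹ := by
    rw [← Real.rpow_natCast, ← Real.rpow_mul hpos.le,
      ← Real.rpow_natCast (1 - ε ^ 2) 2, ← Real.rpow_neg hpos.le]
    norm_num
  have hlog : 0 < -Real.log ε := by linarith [Real.log_neg h0 (by linarith)]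
  have hεlog : ε * -Real.log ε ≤ 1 := by
    linarith [(abs_lt.1 (Real.abs_log_mul_self_lt ε h0 (by linarith))).1]
  rw [hpow]
  generalize Real.log ε = l at *
  obtain ⟨L, rfl⟩ : ∃ L, l = -L := ⟨-l, by ring⟩
  rw [neg_neg] at *
  have heq : ((1 - ε ^ 2) ^ 2)⁻¹ * ((1 - ε ^ 2) * (1 - ε ^ 2 * (1 - 2 * -L)) / (-32 * -L) -
      (1 - ε ^ 2) ^ 2 / 32) + 1 / 32 = (1 - ε ^ 2 * (1 + 2 * L)) / ((1 - ε ^ 2) * (32 * L)) := by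
    field_simp
    ring
  rw [heq, div_le_div_iff₀ (by positivity) (by positivity)]
  have h : 1 / 2 ≤ 1 - ε ^ 2 * (1 + 2 * L) := by
    nlinarith [mul_le_mul_of_nonneg_left hεlog h0.le]
  have h' := mul_le_mul_of_nonneg_right h hlog.le
  nlinarith [mul_nonneg (sq_nonneg ε) hlog.le]


/-- counterexample, `d = 2`: for every `γ < 0`, for all small `ε > 0` the
area-normalized planar annulus satisfies `(P + γE)(Ω̃_ε) < (P + γE)(B₁)`, expressed via the
explicit values `μ_ε(1+ε) − 1` and `μ_ε⁴ f₂(ε) + 1/32` with `μ_ε = (1 − ε²)^{−1/2}`. -/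
theorem statement16 (μ f₂ : ℝ → ℝ)
    (hμ : ∀ ε : ℝ, 0 < ε → ε < 1 → μ ε = (1 - ε ^ 2) ^ (-(1:ℝ) / 2))
    (hf₂ : ∀ ε : ℝ, 0 < ε → ε < 1 →
      f₂ ε = (1 - ε ^ 2) * (1 - ε ^ 2 * (1 - 2 * Real.log ε)) / (-32 * Real.log ε) -
             (1 - ε ^ 2) ^ 2 / 32) :
    ∀ γ : ℝ, γ < 0 → ∃ ε₀ : ℝ, 0 < ε₀ ∧ ε₀ < 1 ∧ ∀ ε : ℝ, 0 < ε → ε < ε₀ →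
      (μ ε * (1 + ε) - 1) + γ * ((μ ε) ^ 4 * f₂ ε + 1 / 32) < 0 := by
  intro γ hγ
  have hlim : ∀ᶠ ε in nhdsWithin (0 : ℝ) (Set.Ioi 0), γ / 128 < Real.log ε * ε := by
    have h := tendsto_log_mul_rpow_nhdsGT_zero one_pos
    simp only [Real.rpow_one] at h
    exact h.eventually (lt_mem_nhds (by linarith))
  obtain ⟨δ, hδ, hsub⟩ := mem_nhdsGT_iff_exists_Ioo_subset.1 hlim
  refine ⟨min δ (1 / 5), lt_min hδ (by norm_num), (min_le_right _ _).trans_lt (by norm_num), ?_⟩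
  intro ε h0 hε
  have hε' : ε < 1 / 5 := hε.trans_le (min_le_right _ _)
  have hsmall : γ / 128 < Real.log ε * ε := hsub ⟨h0, hε.trans_le (min_le_left _ _)⟩
  rw [hμ ε h0 (by linarith), hf₂ ε h0 (by linarith)]
  have hP := annulus_perimeter_excess_le h0 (by linarith)
  have hE := mul_le_mul_of_nonpos_left (le_annulus_energy_excess h0 hε'.le) hγ.le
  have hlog : 0 < -Real.log ε := by linarith [Real.log_neg h0 (by linarith)]
  have hlt : 2 * ε < -γ * (1 / (64 * -Real.log ε)) := by
    rw [mul_one_div, lt_div_iff₀ (by positivity)]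
    linarith
  linarith
end
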